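/- Let m ≥ 1 be an integer and let a, b, c be real numbers with a > 0, b > 0, c ≥ 0. Define S_m(a,b,c) = ∫_{0 < t_1 < ⋯ < t_m < 1} (∏_{k=1}^m t_k^(a−1) (1−t_k)^(b−1)) · ∏_{1 ≤ k < l ≤ m} (t_l − t_k)^(2c) dt_1 ⋯ dt_m, the (ordered-domain) Selberg integral, which is finite under these hypotheses. Then S_m(a+1, b, c) = ( ∏_{k=1}^m (a + c(m−k)) / (a + b + c(2m−k−1)) ) · S_m(a, b, c). -/

import Mathlib

open MeasureTheory

/-- The ordered Selberg integral
`S_m(a,b,c) = ∫_{0 < t₁ < ⋯ < t_m < 1} (∏ k, t_k^(a−1) (1−t_k)^(b−1))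
  ∏_{k<l} (t_l − t_k)^(2c) dt`. -/
noncomputable def selbergOrdered (m : ℕ) (a b c : ℝ) : ℝ :=
  ∫ t in {t : Fin m → ℝ | StrictMono t ∧ ∀ i, 0 < t i ∧ t i < 1},
    (∏ k : Fin m, (t k) ^ (a - 1) * (1 - t k) ^ (b - 1)) *
      ∏ p ∈ Finset.univ.filter (fun p : Fin m × Fin m => p.1 < p.2),
        (t p.2 - t p.1) ^ (2 * c)

/-- Lebesgue measure on the open unit cube `(0, 1)ⁿ`. -/
noncomputable abbrev cubeMeasure (n : ℕ) : Measure (Fin n → ℝ) :=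
  Measure.pi fun _ => volume.restrict (Set.Ioo (0 : ℝ) 1)

/-- The density of the (unnormalised) beta distribution. -/
noncomputable def betaWeight (a b x : ℝ) : ℝ := x ^ (a - 1) * (1 - x) ^ (b - 1)

/-- The symmetric interaction `∏_{k ≠ l} |t k - t l| ^ c`, each unordered pair being counted
twice. -/
noncomputable def interaction {n : ℕ} (c : ℝ) (t : Fin n → ℝ) : ℝ :=
  ∏ k, ∏ l, if k = l then 1 else |t k - t l| ^ c

/-- The symmetric Selberg density on the unit cube. -/
noncomputable def selbergDensity {n : ℕ} (a b c : ℝ) (t : Fin n → ℝ) : ℝ :=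
  (∏ k, betaWeight a b (t k)) * interaction c t

/-- The moment `∫ (∏_{k ∈ S} t k) Φ(t) dt` of the Selberg density over the unit cube. -/
noncomputable def selbergMoment {n : ℕ} (a b c : ℝ) (S : Finset (Fin n)) : ℝ :=
  ∫ t, (∏ k ∈ S, t k) * selbergDensity a b c t ∂cubeMeasure n

section Measure

lemma ae_mem_cube (n : ℕ) : ∀ᵐ t ∂cubeMeasure n, ∀ i, t i ∈ Set.Ioo (0 : ℝ) 1 := by
  rw [cubeMeasure, ← Measure.restrict_pi_pi]
  filter_upwards [ae_restrict_mem (MeasurableSet.univ_pi fun _ => measurableSet_Ioo)] with t ht i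
  exact ht i (Set.mem_univ i)

lemma measurePreserving_comp_perm {n : ℕ} (ν : Measure ℝ) [SigmaFinite ν]
    (σ : Equiv.Perm (Fin n)) :
    MeasurePreserving (fun t : Fin n → ℝ => t ∘ σ) (Measure.pi fun _ => ν)
      (Measure.pi fun _ => ν) := by
  convert! measurePreserving_piCongrLeft (α := fun _ : Fin n => ℝ) (fun _ => ν) σ.symm using 1
  ext t k
  obtain ⟨j, rfl⟩ := σ.symm.surjective k
  simp [MeasurableEquiv.coe_piCongrLeft, Equiv.piCongrLeft_apply_apply]

lemma integral_comp_perm {n : ℕ} (ν : Measure ℝ) [SigmaFinite ν] (σ : Equiv.Perm (Fin n))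
    (f : (Fin n → ℝ) → ℝ) :
    ∫ t, f (t ∘ σ) ∂(Measure.pi fun _ => ν) = ∫ t, f t ∂(Measure.pi fun _ => ν) :=
  (measurePreserving_comp_perm ν σ).integral_comp
    (MeasurableEquiv.arrowCongr' σ.symm (MeasurableEquiv.refl ℝ)).measurableEmbedding f

lemma integrable_comp_perm {n : ℕ} {ν : Measure ℝ} [SigmaFinite ν] (σ : Equiv.Perm (Fin n))
    {f : (Fin n → ℝ) → ℝ} (hf : Integrable f (Measure.pi fun _ => ν)) :
    Integrable (fun t => f (t ∘ σ)) (Measure.pi fun _ => ν) :=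
  (measurePreserving_comp_perm ν σ).integrable_comp_of_integrable hf

lemma measurePreserving_insertNth {n : ℕ} (i : Fin (n + 1)) :
    MeasurePreserving (fun p : ℝ × (Fin n → ℝ) => i.insertNth (α := fun _ => ℝ) p.1 p.2)
      ((volume.restrict (Set.Ioo (0 : ℝ) 1)).prod (cubeMeasure n)) (cubeMeasure (n + 1)) :=
  (measurePreserving_piFinSuccAbove (fun _ => volume.restrict (Set.Ioo (0 : ℝ) 1)) i).symm _

lemma integrable_insertNth_iff {n : ℕ} (i : Fin (n + 1)) {f : (Fin (n + 1) → ℝ) → ℝ} :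
    Integrable (fun p : ℝ × (Fin n → ℝ) => f (i.insertNth p.1 p.2))
      ((volume.restrict (Set.Ioo (0 : ℝ) 1)).prod (cubeMeasure n)) ↔
        Integrable f (cubeMeasure (n + 1)) :=
  (measurePreserving_insertNth i).integrable_comp_emb
    (MeasurableEquiv.piFinSuccAbove (fun _ => ℝ) i).symm.measurableEmbedding

lemma integral_insertNth {n : ℕ} (i : Fin (n + 1)) (f : (Fin (n + 1) → ℝ) → ℝ) :
    ∫ p : ℝ × (Fin n → ℝ), f (i.insertNth p.1 p.2)
      ∂((volume.restrict (Set.Ioo (0 : ℝ) 1)).prod (cubeMeasure n)) =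
        ∫ t, f t ∂cubeMeasure (n + 1) :=
  (measurePreserving_insertNth i).integral_comp
    (MeasurableEquiv.piFinSuccAbove (fun _ => ℝ) i).symm.measurableEmbedding f

lemma ae_mem_cube_prod (n : ℕ) :
    ∀ᵐ p ∂((volume.restrict (Set.Ioo (0 : ℝ) 1)).prod (cubeMeasure n)),
      p.1 ∈ Set.Ioo (0 : ℝ) 1 ∧ ∀ i, p.2 i ∈ Set.Ioo (0 : ℝ) 1 := by
  filter_upwards [Measure.quasiMeasurePreserving_fst.ae
      (ae_restrict_mem (measurableSet_Ioo (a := (0 : ℝ)) (b := 1))),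
    Measure.quasiMeasurePreserving_snd.ae (ae_mem_cube n)] with p hp1 hp2
  exact ⟨hp1, hp2⟩

end Measure

section Density

variable {n : ℕ} {a b c : ℝ}

lemma betaWeight_nonneg {x : ℝ} (hx : x ∈ Set.Ioo (0 : ℝ) 1) : 0 ≤ betaWeight a b x :=
  mul_nonneg (Real.rpow_nonneg hx.1.le _) (Real.rpow_nonneg (by linarith [hx.2]) _)

lemma betaWeight_mul {x : ℝ} (hx : x ∈ Set.Ioo (0 : ℝ) 1) :
    betaWeight a b x * (x * (1 - x)) = x ^ a * (1 - x) ^ b := by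
  have h1 : 0 < 1 - x := by linarith [hx.2]
  rw [betaWeight, Real.rpow_sub_one hx.1.ne', Real.rpow_sub_one h1.ne']
  have := hx.1.ne'
  have := h1.ne'
  field_simp

lemma betaWeight_add_one {x : ℝ} (hx : x ∈ Set.Ioo (0 : ℝ) 1) :
    betaWeight (a + 1) b x = x * betaWeight a b x := by
  rw [betaWeight, betaWeight, add_sub_cancel_right, Real.rpow_sub_one hx.1.ne']
  have := hx.1.ne'
  field_simp

lemma measurable_betaWeight : Measurable (betaWeight a b) := by
  unfold betaWeight
  fun_prop

lemma integrable_betaWeight (ha : 0 < a) (hb : 0 < b) :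
    Integrable (betaWeight a b) (volume.restrict (Set.Ioo (0 : ℝ) 1)) := by
  have h := (Complex.betaIntegral_convergent (u := a) (v := b) (by simpa) (by simpa)).norm
  rw [intervalIntegrable_iff_integrableOn_Ioo_of_le zero_le_one] at h
  refine h.congr ?_
  filter_upwards [ae_restrict_mem measurableSet_Ioo] with x hx
  have h1 : 0 < 1 - x := by linarith [hx.2]
  rw [norm_mul, Complex.norm_cpow_eq_rpow_re_of_pos hx.1]
  have : (1 - (x : ℂ)) = ((1 - x : ℝ) : ℂ) := by push_cast; ring
  rw [this, Complex.norm_cpow_eq_rpow_re_of_pos h1]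
  simp [betaWeight]

lemma interaction_nonneg (t : Fin n → ℝ) : 0 ≤ interaction c t :=
  Finset.prod_nonneg fun k _ => Finset.prod_nonneg fun l _ => by split_ifs <;> positivity

lemma abs_sub_le_one {x y : ℝ} (hx : x ∈ Set.Ioo (0 : ℝ) 1) (hy : y ∈ Set.Ioo (0 : ℝ) 1) :
    |x - y| ≤ 1 := by
  rw [abs_le]
  constructor <;> linarith [hx.1, hx.2, hy.1, hy.2]

lemma interaction_le_one (hc : 0 ≤ c) {t : Fin n → ℝ} (ht : ∀ i, t i ∈ Set.Ioo (0 : ℝ) 1) :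
    interaction c t ≤ 1 := by
  refine Finset.prod_le_one (fun k _ => Finset.prod_nonneg fun l _ => ?_) fun k _ =>
    Finset.prod_le_one (fun l _ => ?_) fun l _ => ?_
  · split_ifs <;> positivity
  · split_ifs <;> positivity
  · split_ifs
    · exact le_rfl
    · exact Real.rpow_le_one (abs_nonneg _) (abs_sub_le_one (ht k) (ht l)) hc

lemma interaction_comp_perm (σ : Equiv.Perm (Fin n)) (t : Fin n → ℝ) :
    interaction c (t ∘ σ) = interaction c t := by
  unfold interaction
  rw [← Equiv.prod_comp σ fun k => ∏ l, if k = l then 1 else |t k - t l| ^ c]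
  refine Finset.prod_congr rfl fun k _ => ?_
  rw [← Equiv.prod_comp σ (fun l => if σ k = l then 1 else |t (σ k) - t l| ^ c)]
  simp [σ.injective.eq_iff]

lemma selbergDensity_comp_perm (σ : Equiv.Perm (Fin n)) (t : Fin n → ℝ) :
    selbergDensity a b c (t ∘ σ) = selbergDensity a b c t := by
  rw [selbergDensity, selbergDensity, interaction_comp_perm]
  congr 1
  exact Equiv.prod_comp σ fun k => betaWeight a b (t k)

lemma measurable_interaction : Measurable (interaction (n := n) c) := by
  unfold interaction
  refine Finset.measurable_prod _ fun k _ => Finset.measurable_prod _ fun l _ => ?_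
  split_ifs <;> fun_prop

lemma measurable_selbergDensity : Measurable (selbergDensity (n := n) a b c) :=
  (Finset.measurable_prod _ fun k _ => measurable_betaWeight.comp (measurable_pi_apply k)).mul
    measurable_interaction

lemma integrable_prod_betaWeight (ha : 0 < a) (hb : 0 < b) :
    Integrable (fun t : Fin n → ℝ => ∏ k, betaWeight a b (t k)) (cubeMeasure n) :=
  Integrable.fintype_prod (f := fun _ => betaWeight a b) fun _ => integrable_betaWeight ha hb

lemma integrable_selbergDensity (ha : 0 < a) (hb : 0 < b) (hc : 0 ≤ c) :
    Integrable (selbergDensity (n := n) a b c) (cubeMeasure n) := by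
  refine (integrable_prod_betaWeight ha hb).mono' measurable_selbergDensity.aestronglyMeasurable ?_
  filter_upwards [ae_mem_cube n] with t ht
  have h0 : 0 ≤ ∏ k, betaWeight a b (t k) := Finset.prod_nonneg fun k _ => betaWeight_nonneg (ht k)
  rw [selbergDensity, Real.norm_of_nonneg (mul_nonneg h0 (interaction_nonneg t))]
  exact mul_le_of_le_one_right h0 (interaction_le_one hc ht)

lemma abs_prod_le_one {t : Fin n → ℝ} (ht : ∀ i, t i ∈ Set.Ioo (0 : ℝ) 1)
    (S : Finset (Fin n)) : |∏ k ∈ S, t k| ≤ 1 := by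
  rw [abs_of_nonneg (Finset.prod_nonneg fun k _ => (ht k).1.le)]
  exact Finset.prod_le_one (fun k _ => (ht k).1.le) fun k _ => (ht k).2.le

lemma integrable_prod_mul_selbergDensity (ha : 0 < a) (hb : 0 < b) (hc : 0 ≤ c)
    (S : Finset (Fin n)) :
    Integrable (fun t => (∏ k ∈ S, t k) * selbergDensity a b c t) (cubeMeasure n) := by
  refine (integrable_selbergDensity ha hb hc).bdd_mul (c := 1)
    (by fun_prop) ?_
  filter_upwards [ae_mem_cube n] with t ht
  exact abs_prod_le_one ht S

lemma interaction_insertNth (i : Fin (n + 1)) (x : ℝ) (y : Fin n → ℝ) :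
    interaction c (i.insertNth (α := fun _ => ℝ) x y) =
      (∏ j, |x - y j| ^ (2 * c)) * interaction c y := by
  have h (u : ℝ) : |u| ^ (2 * c) = |u| ^ c * |u| ^ c := by
    rw [mul_comm, Real.rpow_mul (abs_nonneg u), Real.rpow_two, sq]
  simp_rw [interaction, Fin.prod_univ_succAbove _ i, h, Finset.prod_mul_distrib]
  simp [Fin.succAbove_ne, (Fin.succAbove_ne _ _).symm, abs_sub_comm, mul_assoc]

end Density

section Derivative

variable {n : ℕ} {a b c : ℝ}

lemma integrableOn_abs_rpow {r : ℝ} (hr : -1 < r) :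
    IntegrableOn (fun u : ℝ => |u| ^ r) (Set.Ioo (-1) 1) := by
  have h1 : IntervalIntegrable (fun u : ℝ => |u| ^ r) volume 0 1 := by
    refine (intervalIntegral.intervalIntegrable_rpow' hr).congr fun u hu => ?_
    rw [Set.uIoc_of_le zero_le_one] at hu
    simp only [abs_of_pos hu.1]
  have h2 : IntervalIntegrable (fun u : ℝ => |u| ^ r) volume (-1) 0 := by
    rw [IntervalIntegrable.iff_comp_neg]
    simpa using h1.symm
  exact (intervalIntegrable_iff_integrableOn_Ioo_of_le (by norm_num)).1 (h2.trans h1)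

lemma integrable_betaWeight_mul_abs_rpow (ha : 0 < a) (hb : 0 < b) {r : ℝ} (hr : -1 < r)
    (j : Fin n) :
    Integrable (fun p : ℝ × (Fin n → ℝ) => (∏ k, betaWeight a b (p.2 k)) * |p.1 - p.2 j| ^ r)
      ((volume.restrict (Set.Ioo (0 : ℝ) 1)).prod (cubeMeasure n)) := by
  set h : ℝ → ℝ := (Set.Ioo (-1) 1).indicator fun u => |u| ^ r with hh
  have h_int : Integrable h := (integrable_indicator_iff measurableSet_Ioo).2
    (integrableOn_abs_rpow hr)
  have h_meas : Measurable h := Measurable.indicator (by fun_prop) measurableSet_Ioo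
  have hW := integrable_prod_betaWeight (n := n) ha hb
  have W_meas : Measurable fun t : Fin n → ℝ => ∏ k, betaWeight a b (t k) :=
    Finset.measurable_prod _ fun k _ => measurable_betaWeight.comp (measurable_pi_apply k)
  have key : Integrable
      (fun p : ℝ × (Fin n → ℝ) => (∏ k, betaWeight a b (p.2 k)) * h (p.1 - p.2 j))
      (volume.prod (cubeMeasure n)) := by
    rw [integrable_prod_iff']
    · refine ⟨Filter.Eventually.of_forall fun y =>
        (h_int.comp_sub_right (y j)).const_mul (∏ k, betaWeight a b (y k)), ?_⟩
      simp only [norm_mul, integral_const_mul]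
      simp only [integral_sub_right_eq_self fun u => ‖h u‖]
      exact hW.norm.mul_const _
    · exact ((W_meas.comp measurable_snd).mul
        (h_meas.comp (by fun_prop))).aestronglyMeasurable
  have key' := key.mono_measure
    (Measure.prod_mono (Measure.restrict_le_self (s := Set.Ioo (0 : ℝ) 1))
      (le_refl (cubeMeasure n)))
  refine key'.congr ?_
  filter_upwards [ae_mem_cube_prod n] with p ⟨hp1, hp2⟩
  have : p.1 - p.2 j ∈ Set.Ioo (-1 : ℝ) 1 :=
    ⟨by linarith [hp1.1, (hp2 j).2], by linarith [hp1.2, (hp2 j).1]⟩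
  simp only [hh, Set.indicator_of_mem this]

lemma selbergDensity_insertNth_mul (i : Fin (n + 1)) {x : ℝ} (hx : x ∈ Set.Ioo (0 : ℝ) 1)
    (y : Fin n → ℝ) :
    selbergDensity a b c (i.insertNth (α := fun _ => ℝ) x y) * (x * (1 - x)) =
      selbergDensity a b c y * (x ^ a * (1 - x) ^ b * ∏ j, |x - y j| ^ (2 * c)) := by
  rw [← betaWeight_mul hx, selbergDensity, selbergDensity, interaction_insertNth,
    Fin.prod_univ_succAbove _ i]
  simp only [Fin.insertNth_apply_same, Fin.insertNth_apply_succAbove]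
  ring

lemma prod_abs_rpow_div_le (hc : 0 ≤ c) {x : ℝ} (hx : x ∈ Set.Ioo (0 : ℝ) 1) {y : Fin n → ℝ}
    (hy : ∀ i, y i ∈ Set.Ioo (0 : ℝ) 1) (j : Fin n) :
    (∏ k, |x - y k| ^ (2 * c)) / |x - y j| ≤ |x - y j| ^ (2 * c - 1) := by
  rcases eq_or_ne (x - y j) 0 with h | h
  · simp only [h, abs_zero, div_zero]
    positivity
  · rw [Real.rpow_sub_one (abs_ne_zero.2 h)]
    gcongr
    rw [← Finset.mul_prod_erase _ _ (Finset.mem_univ j)]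
    refine mul_le_of_le_one_right (by positivity) (Finset.prod_le_one (fun k _ => by positivity)
      fun k _ => Real.rpow_le_one (abs_nonneg _) (abs_sub_le_one hx (hy k)) (by positivity))

/-- The part of the logarithmic derivative in `t i` coming from the factor `|t i - t j|^(2c)`. -/
noncomputable def pairTerm (a b c : ℝ) (S : Finset (Fin n)) (i j : Fin n) (t : Fin n → ℝ) : ℝ :=
  c * ((∏ k ∈ S, t k) * selbergDensity a b c t * (t i * (1 - t i)) / (t i - t j))

lemma integrable_pairTerm (ha : 0 < a) (hb : 0 < b) (hc : 0 ≤ c) (S : Finset (Fin n))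
    (i j : Fin n) : Integrable (pairTerm a b c S i j) (cubeMeasure n) := by
  rcases hc.eq_or_lt with rfl | hc'
  · exact (integrable_zero _ _ _).congr (.of_forall fun t => by simp [pairTerm])
  rcases eq_or_ne j i with rfl | hij
  · exact (integrable_zero _ _ _).congr (.of_forall fun t => by simp [pairTerm])
  cases n with
  | zero => exact i.elim0
  | succ n =>
  obtain ⟨j, rfl⟩ := Fin.exists_succAbove_eq hij
  refine Integrable.const_mul ?_ _
  rw [← integrable_insertNth_iff i]
  refine (integrable_betaWeight_mul_abs_rpow ha hb (r := 2 * c - 1) (by linarith) j).mono'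
    (Measurable.aestronglyMeasurable ?_) ?_
  · refine Measurable.comp (g := fun t : Fin (n + 1) → ℝ => (∏ k ∈ S, t k) *
      selbergDensity a b c t * (t i * (1 - t i)) / (t i - t (i.succAbove j))) ?_
      (measurePreserving_insertNth i).measurable
    have := measurable_selbergDensity (n := n + 1) (a := a) (b := b) (c := c)
    fun_prop
  · filter_upwards [ae_mem_cube_prod n] with ⟨x, y⟩ ⟨hx, hy⟩
    have hmem : ∀ k, i.insertNth (α := fun _ => ℝ) x y k ∈ Set.Ioo (0 : ℝ) 1 := by
      rw [Fin.forall_iff_succAbove i]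
      simpa using And.intro hx hy
    simp only [Fin.insertNth_apply_same, Fin.insertNth_apply_succAbove]
    rw [mul_assoc, selbergDensity_insertNth_mul i hx, norm_div, norm_mul, mul_div_assoc]
    refine (mul_le_of_le_one_left (by positivity) (abs_prod_le_one hmem S)).trans ?_
    have hx1 : 0 < 1 - x := by linarith [hx.2]
    have hW : 0 ≤ ∏ k, betaWeight a b (y k) :=
      Finset.prod_nonneg fun k _ => betaWeight_nonneg (hy k)
    have h0 : 0 ≤ selbergDensity a b c y := mul_nonneg hW (interaction_nonneg y)
    have hx0 := hx.1
    have hle : selbergDensity a b c y ≤ ∏ k, betaWeight a b (y k) :=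
      mul_le_of_le_one_right hW (interaction_le_one hc hy)
    have hpow : x ^ a * (1 - x) ^ b ≤ 1 :=
      mul_le_one₀ (Real.rpow_le_one hx0.le hx.2.le ha.le) (by positivity)
        (Real.rpow_le_one hx1.le (by linarith) hb.le)
    rw [Real.norm_of_nonneg (by positivity), Real.norm_eq_abs, mul_div_assoc]
    refine mul_le_mul hle ?_ (by positivity) hW
    rw [mul_div_assoc]
    exact (mul_le_of_le_one_left (by positivity) hpow).trans (prod_abs_rpow_div_le hc hx hy j)

lemma hasDerivAt_prod_of_logDeriv {ι : Type*} (s : Finset ι) {f : ι → ℝ → ℝ} {g : ι → ℝ} {x : ℝ}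
    (h : ∀ j ∈ s, HasDerivAt (f j) (f j x * g j) x) :
    HasDerivAt (fun x => ∏ j ∈ s, f j x) ((∏ j ∈ s, f j x) * ∑ j ∈ s, g j) x := by
  classical
  induction s using Finset.induction_on with
  | empty => simpa using hasDerivAt_const x (1 : ℝ)
  | insert j s hj ih =>
    simp only [Finset.prod_insert hj, Finset.sum_insert hj]
    convert! (h j (by simp)).mul (ih fun k hk => h k (by simp [hk])) using 1
    ring

lemma hasDerivAt_abs_sub_rpow {r x y : ℝ} (h : x ≠ y) :
    HasDerivAt (fun x => |x - y| ^ r) (|x - y| ^ r * (r / (x - y))) x := by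
  have h' : x - y ≠ 0 := sub_ne_zero.2 h
  have h1 := (HasDerivAt.comp_sub_const x y (hasDerivAt_abs h')).rpow_const (p := r)
    (Or.inl (abs_ne_zero.2 h'))
  convert! h1 using 1
  rw [Real.rpow_sub_one (abs_ne_zero.2 h')]
  rcases h'.lt_or_gt with h | h
  · rw [abs_of_neg h, sign_neg h]
    simp
    field_simp
    ring
  · rw [abs_of_pos h, sign_pos h]
    simp
    field_simp

lemma hasDerivAt_section {x : ℝ} (hx : x ∈ Set.Ioo (0 : ℝ) 1) {y : Fin n → ℝ}
    (hxy : ∀ j, x ≠ y j) :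
    HasDerivAt (fun x => x ^ a * (1 - x) ^ b * ∏ j, |x - y j| ^ (2 * c))
      (x ^ a * (1 - x) ^ b * (∏ j, |x - y j| ^ (2 * c)) *
        (a / x - b / (1 - x) + ∑ j, 2 * c / (x - y j))) x := by
  have hx0 := hx.1.ne'
  have hx1 : 1 - x ≠ 0 := by linarith [hx.2]
  have h1 : HasDerivAt (fun x : ℝ => x ^ a) (x ^ a * (a / x)) x := by
    convert! Real.hasDerivAt_rpow_const (p := a) (Or.inl hx0) using 1
    rw [Real.rpow_sub_one hx0]
    ring
  have h2 : HasDerivAt (fun x : ℝ => (1 - x) ^ b) ((1 - x) ^ b * (-b / (1 - x))) x := by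
    convert! ((hasDerivAt_id x).const_sub 1).rpow_const (p := b) (Or.inl hx1) using 1
    rw [id, Real.rpow_sub_one hx1]
    ring
  convert! (h1.mul h2).mul (hasDerivAt_prod_of_logDeriv Finset.univ fun j _ =>
    hasDerivAt_abs_sub_rpow (r := 2 * c) (hxy j)) using 1
  simp only [Pi.mul_apply]
  ring

lemma continuous_section (ha : 0 < a) (hb : 0 < b) (hc : 0 ≤ c) (y : Fin n → ℝ) :
    Continuous (fun x : ℝ => x ^ a * (1 - x) ^ b * ∏ j, |x - y j| ^ (2 * c)) := by
  refine ((Real.continuous_rpow_const ha.le).mul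
    ((Real.continuous_rpow_const hb.le).comp (by fun_prop))).mul ?_
  exact continuous_finsetProd _ fun j _ =>
    (Real.continuous_rpow_const (by positivity)).comp (by fun_prop)

/-- The total derivative in `t i` integrates to zero over the cube. -/
lemma integral_derivative_eq_zero (ha : 0 < a) (hb : 0 < b) (hc : 0 ≤ c) (S : Finset (Fin n))
    {i : Fin n} (hi : i ∉ S) :
    ∫ t, (a * ((∏ k ∈ S, t k) * selbergDensity a b c t)
      - (a + b) * ((∏ k ∈ insert i S, t k) * selbergDensity a b c t)
      + 2 * ∑ j, pairTerm a b c S i j t) ∂cubeMeasure n = 0 := by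
  have hint : Integrable (fun t => a * ((∏ k ∈ S, t k) * selbergDensity a b c t)
      - (a + b) * ((∏ k ∈ insert i S, t k) * selbergDensity a b c t)
      + 2 * ∑ j, pairTerm a b c S i j t) (cubeMeasure n) :=
    (((integrable_prod_mul_selbergDensity ha hb hc S).const_mul _).sub
      ((integrable_prod_mul_selbergDensity ha hb hc (insert i S)).const_mul _)).add
      ((integrable_finsetSum _ fun j _ => integrable_pairTerm ha hb hc S i j).const_mul _)
  cases n with
  | zero => exact i.elim0
  | succ n =>
  rw [← integrable_insertNth_iff i] at hint
  rw [← integral_insertNth i, integral_prod_symm _ hint]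
  refine integral_eq_zero_of_ae ?_
  filter_upwards [hint.prod_left_ae] with y hy
  set C := (∏ k ∈ S, i.insertNth (α := fun _ => ℝ) 0 y k) * selbergDensity a b c y
  have hC (x : ℝ) : ∏ k ∈ S, i.insertNth (α := fun _ => ℝ) x y k =
      ∏ k ∈ S, i.insertNth (α := fun _ => ℝ) 0 y k := by
    refine Finset.prod_congr rfl fun k hk => ?_
    obtain ⟨k, rfl⟩ := Fin.exists_succAbove_eq (ne_of_mem_of_not_mem hk hi)
    simp
  rw [Pi.zero_apply, ← integral_Ioc_eq_integral_Ioo, ← intervalIntegral.integral_of_le zero_le_one,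
    integral_eq_of_hasDerivAt_off_countable_of_le
      (fun x => C * (x ^ a * (1 - x) ^ b * ∏ j, |x - y j| ^ (2 * c))) _ zero_le_one
      (Set.countable_range y) ((continuous_section ha hb hc y).const_mul C).continuousOn ?_
      ((intervalIntegrable_iff_integrableOn_Ioo_of_le zero_le_one).2 hy)]
  · simp [Real.zero_rpow ha.ne', Real.zero_rpow hb.ne']
  · rintro x ⟨hx, hxy⟩
    convert! (hasDerivAt_section (a := a) (b := b) (c := c) hx (y := y)
      fun j h => hxy ⟨j, h.symm⟩).const_mul C using 1
    have hx0 := hx.1.ne'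
    have hx1 : 1 - x ≠ 0 := by linarith [hx.2]
    simp only [pairTerm, Fin.sum_univ_succAbove _ i, Finset.prod_insert hi, hC,
      Fin.insertNth_apply_same, Fin.insertNth_apply_succAbove, sub_self, div_zero, mul_zero,
      zero_add, C]
    have key := selbergDensity_insertNth_mul (a := a) (b := b) (c := c) i hx y
    rw [← eq_div_iff (mul_ne_zero hx0 hx1)] at key
    simp only [key, mul_add, Finset.mul_sum]
    congr 1
    · field_simp
      ring
    · refine Finset.sum_congr rfl fun j _ => ?_
      field_simp

end Derivative

section Recurrence

variable {n : ℕ} {a b c : ℝ}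

lemma selbergDensity_eq_zero_of_eq (hc : c ≠ 0) {i j : Fin n} (hij : i ≠ j) {t : Fin n → ℝ}
    (h : t i = t j) : selbergDensity a b c t = 0 := by
  refine mul_eq_zero_of_right _ (Finset.prod_eq_zero (Finset.mem_univ i)
    (Finset.prod_eq_zero (Finset.mem_univ j) ?_))
  simp [hij, h, Real.zero_rpow hc]

/-- Swapping `t i` and `t j` symmetrises the pair term. -/
lemma two_mul_integral_pairTerm (ha : 0 < a) (hb : 0 < b) (hc : 0 ≤ c) (S : Finset (Fin n))
    (i j : Fin n) :
    2 * ∫ t, pairTerm a b c S i j t ∂cubeMeasure n =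
      ∫ t, (pairTerm a b c S i j t + pairTerm a b c S i j (t ∘ Equiv.swap i j))
        ∂cubeMeasure n := by
  have h := integrable_pairTerm ha hb hc S i j
  rw [integral_add h (integrable_comp_perm (Equiv.swap i j) h), integral_comp_perm, two_mul]

lemma selbergMoment_insert_swap {S : Finset (Fin n)} {i j : Fin n} (hi : i ∉ S) (hj : j ∉ S) :
    selbergMoment a b c (insert j S) = selbergMoment a b c (insert i S) := by
  rw [selbergMoment, ← integral_comp_perm _ (Equiv.swap i j)]
  refine integral_congr_ae (.of_forall fun t => ?_)
  simp only [selbergDensity_comp_perm, Finset.prod_insert hi, Finset.prod_insert hj,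
    Function.comp_apply, Equiv.swap_apply_right]
  congr 2
  refine Finset.prod_congr rfl fun k hk => ?_
  rw [Equiv.swap_apply_of_ne_of_ne (ne_of_mem_of_not_mem hk hi) (ne_of_mem_of_not_mem hk hj)]

lemma two_mul_integral_pairTerm_of_mem (ha : 0 < a) (hb : 0 < b) (hc : 0 ≤ c)
    {S : Finset (Fin n)} {i j : Fin n} (hi : i ∉ S) (hj : j ∈ S) :
    2 * ∫ t, pairTerm a b c S i j t ∂cubeMeasure n = -c * selbergMoment a b c (insert i S) := by
  rw [two_mul_integral_pairTerm ha hb hc, selbergMoment, ← integral_const_mul]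
  refine integral_congr_ae (.of_forall fun t => ?_)
  have hij : i ≠ j := (ne_of_mem_of_not_mem hj hi).symm
  have hS : ∏ k ∈ S.erase j, t (Equiv.swap i j k) = ∏ k ∈ S.erase j, t k := by
    refine Finset.prod_congr rfl fun k hk => ?_
    rw [Finset.mem_erase] at hk
    rw [Equiv.swap_apply_of_ne_of_ne (ne_of_mem_of_not_mem hk.2 hi) hk.1]
  simp only [pairTerm, selbergDensity_comp_perm, Finset.prod_insert hi,
    ← Finset.mul_prod_erase _ _ hj, Function.comp_apply, Equiv.swap_apply_left,
    Equiv.swap_apply_right, hS]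
  rcases eq_or_ne c 0 with rfl | hc0
  · simp
  rcases eq_or_ne (t i) (t j) with h | h
  · simp [selbergDensity_eq_zero_of_eq hc0 hij h]
  have h1 : t i - t j ≠ 0 := sub_ne_zero.2 h
  rw [← neg_sub (t i) (t j)]
  field_simp
  ring

lemma two_mul_integral_pairTerm_of_notMem (ha : 0 < a) (hb : 0 < b) (hc : 0 ≤ c)
    {S : Finset (Fin n)} {i j : Fin n} (hij : i ≠ j) (hi : i ∉ S) (hj : j ∉ S) :
    2 * ∫ t, pairTerm a b c S i j t ∂cubeMeasure n =
      c * (selbergMoment a b c S - 2 * selbergMoment a b c (insert i S)) := by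
  have hJ (T : Finset (Fin n)) := integrable_prod_mul_selbergDensity ha hb hc T
  have : c * (selbergMoment a b c S - 2 * selbergMoment a b c (insert i S)) =
      c * (selbergMoment a b c S - selbergMoment a b c (insert i S)
        - selbergMoment a b c (insert j S)) := by
    rw [selbergMoment_insert_swap hi hj]
    ring
  rw [two_mul_integral_pairTerm ha hb hc, this, selbergMoment, selbergMoment, selbergMoment,
    ← integral_sub (hJ _) (hJ _), ← integral_sub ((hJ _).sub' (hJ _)) (hJ _), ← integral_const_mul]
  refine integral_congr_ae (.of_forall fun t => ?_)
  have hS : ∏ k ∈ S, t (Equiv.swap i j k) = ∏ k ∈ S, t k := by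
    refine Finset.prod_congr rfl fun k hk => ?_
    rw [Equiv.swap_apply_of_ne_of_ne (ne_of_mem_of_not_mem hk hi) (ne_of_mem_of_not_mem hk hj)]
  simp only [pairTerm, selbergDensity_comp_perm, Finset.prod_insert hi, Finset.prod_insert hj,
    Function.comp_apply, Equiv.swap_apply_left, Equiv.swap_apply_right, hS]
  rcases eq_or_ne c 0 with rfl | hc0
  · simp
  rcases eq_or_ne (t i) (t j) with h | h
  · simp [selbergDensity_eq_zero_of_eq hc0 hij h]
  have h1 : t i - t j ≠ 0 := sub_ne_zero.2 h
  rw [← neg_sub (t i) (t j)]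
  field_simp
  ring

/-- Aomoto's recurrence for the moments of the Selberg density. -/
lemma selbergMoment_insert (ha : 0 < a) (hb : 0 < b) (hc : 0 ≤ c) {S : Finset (Fin n)}
    {i : Fin n} (hi : i ∉ S) :
    (a + b + c * (2 * n - (S.card + 1) - 1)) * selbergMoment a b c (insert i S) =
      (a + c * (n - (S.card + 1))) * selbergMoment a b c S := by
  have h := integral_derivative_eq_zero ha hb hc S hi
  have hJ (T : Finset (Fin n)) := integrable_prod_mul_selbergDensity ha hb hc T
  have hQ : ∀ j ∈ Finset.univ, Integrable (pairTerm a b c S i j) (cubeMeasure n) :=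
    fun j _ => integrable_pairTerm ha hb hc S i j
  rw [integral_add (((hJ _).const_mul _).sub' ((hJ _).const_mul _))
      ((integrable_finsetSum _ hQ).const_mul _),
    integral_sub ((hJ _).const_mul _) ((hJ _).const_mul _), integral_const_mul, integral_const_mul,
    integral_const_mul, integral_finsetSum _ hQ, Finset.mul_sum,
    ← Finset.sum_add_sum_compl (insert i S), Finset.sum_insert hi] at h
  have h_self : ∫ t, pairTerm a b c S i i t ∂cubeMeasure n = 0 := by simp [pairTerm]
  rw [h_self, Finset.sum_congr rfl fun j hj => two_mul_integral_pairTerm_of_mem ha hb hc hi hj,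
    Finset.sum_congr rfl fun j hj => two_mul_integral_pairTerm_of_notMem ha hb hc
      (i := i) (S := S) (fun h => by simp [h] at hj) hi (fun h => by simp [h] at hj),
    Finset.sum_const, Finset.sum_const, Finset.card_compl, nsmul_eq_mul, nsmul_eq_mul,
    Nat.cast_sub (Finset.card_le_univ _), Finset.card_insert_of_notMem hi, Fintype.card_fin] at h
  change a * selbergMoment a b c S - (a + b) * selbergMoment a b c (insert i S) + _ = 0 at h
  push_cast at h
  linear_combination -h

lemma selbergMoment_eq_prod_mul (ha : 0 < a) (hb : 0 < b) (hc : 0 ≤ c) (S : Finset (Fin n)) :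
    selbergMoment a b c S =
      (∏ k ∈ Finset.Icc 1 S.card, (a + c * ((n : ℝ) - k)) / (a + b + c * (2 * n - k - 1))) *
        selbergMoment a b c (∅ : Finset (Fin n)) := by
  induction S using Finset.induction_on with
  | empty => simp
  | insert i S hi ih =>
    have hcard : ((S.card + 1 : ℕ) : ℝ) ≤ n := by
      rw [← Finset.card_insert_of_notMem hi]
      exact_mod_cast card_finset_fin_le _
    have hn : (1 : ℝ) ≤ n := by exact_mod_cast i.pos
    have hpos : 0 < a + b + c * (2 * n - ((S.card + 1 : ℕ) : ℝ) - 1) :=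
      add_pos_of_pos_of_nonneg (by positivity) (mul_nonneg hc (by linarith))
    rw [Finset.card_insert_of_notMem hi, Finset.prod_Icc_succ_top (by simp), mul_right_comm, ← ih,
      mul_div_assoc', eq_div_iff hpos.ne']
    push_cast
    linear_combination selbergMoment_insert ha hb hc hi

end Recurrence

section Ordered

variable {n : ℕ} {a b c : ℝ}

lemma ae_injective (n : ℕ) : ∀ᵐ t : Fin n → ℝ, Function.Injective t := by
  have h (i j : Fin n) (hij : i ≠ j) : ∀ᵐ t : Fin n → ℝ, t i ≠ t j := by
    have := Measure.addHaar_submodule (volume : Measure (Fin n → ℝ))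
      (LinearMap.ker (LinearMap.proj (R := ℝ) (φ := fun _ : Fin n => ℝ) i - LinearMap.proj j)) (by
        intro h
        have h1 : Pi.single i (1 : ℝ) ∈ (⊤ : Submodule ℝ (Fin n → ℝ)) := Submodule.mem_top
        rw [← h] at h1
        simp [hij.symm] at h1)
    rw [ae_iff]
    convert! this using 2
    ext t
    simp [sub_eq_zero]
  have h' : ∀ᵐ t : Fin n → ℝ, ∀ i j, i ≠ j → t i ≠ t j :=
    ae_all_iff.2 fun i => ae_all_iff.2 fun j => by
      by_cases hij : i = j
      · simp [hij]
      · simpa [hij] using h i j hij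
  filter_upwards [h'] with t ht i j hij
  exact not_imp_not.1 (ht i j) hij

lemma existsUnique_strictMono_comp {t : Fin n → ℝ} (ht : Function.Injective t) :
    ∃! σ : Equiv.Perm (Fin n), StrictMono (t ∘ σ) := by
  refine ⟨Tuple.sort t, (Tuple.monotone_sort t).strictMono_of_injective
    (ht.comp (Tuple.sort t).injective), fun σ hσ => ?_⟩
  have := Tuple.unique_monotone hσ.monotone (Tuple.monotone_sort t)
  ext k
  exact congrArg Fin.val (ht (congrFun this k))

lemma measurableSet_strictMono : MeasurableSet {t : Fin n → ℝ | StrictMono t} := by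
  simp only [StrictMono, Set.ofPred_forall]
  refine .iInter fun i => .iInter fun j => .iInter fun _ => ?_
  exact measurableSet_lt (measurable_pi_apply i) (measurable_pi_apply j)

/-- A symmetric function integrates over the cube to `n!` times its integral over the ordered
chamber. -/
lemma integral_cube_eq_factorial_mul {f : (Fin n → ℝ) → ℝ} (hf : Integrable f (cubeMeasure n))
    (hsymm : ∀ (σ : Equiv.Perm (Fin n)) t, f (t ∘ σ) = f t) :
    ∫ t, f t ∂cubeMeasure n =
      n.factorial * ∫ t, {t : Fin n → ℝ | StrictMono t}.indicator f t ∂cubeMeasure n := by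
  have hg := hf.indicator (measurableSet_strictMono (n := n))
  have hinj : ∀ᵐ t ∂cubeMeasure n, Function.Injective t := by
    rw [cubeMeasure, ← Measure.restrict_pi_pi]
    exact ae_restrict_of_ae (ae_injective n)
  calc ∫ t, f t ∂cubeMeasure n
      = ∫ t, ∑ σ : Equiv.Perm (Fin n),
          {t : Fin n → ℝ | StrictMono t}.indicator f (t ∘ σ) ∂cubeMeasure n := by
        refine integral_congr_ae ?_
        filter_upwards [hinj] with t ht
        obtain ⟨σ, hσ, huniq⟩ := existsUnique_strictMono_comp ht
        rw [Finset.sum_eq_single σ]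
        · rw [Set.indicator_of_mem (by exact hσ), hsymm]
        · intro τ _ hτ
          exact Set.indicator_of_notMem (fun h => hτ (huniq τ h)) _
        · simp
    _ = _ := by
        rw [integral_finsetSum _ fun σ _ =>
          integrable_comp_perm σ hg]
        simp only [integral_comp_perm, Finset.sum_const, Finset.card_univ, Fintype.card_perm,
          Fintype.card_fin, nsmul_eq_mul]

lemma interaction_of_strictMono {t : Fin n → ℝ} (ht : StrictMono t) :
    interaction c t = ∏ p ∈ Finset.univ.filter (fun p : Fin n × Fin n => p.1 < p.2),
      (t p.2 - t p.1) ^ (2 * c) := by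
  have h1 : interaction c t = (∏ p : Fin n × Fin n, if p.1 < p.2 then |t p.1 - t p.2| ^ c else 1) *
      ∏ p : Fin n × Fin n, if p.2 < p.1 then |t p.1 - t p.2| ^ c else 1 := by
    rw [interaction, ← Fintype.prod_prod_type', ← Finset.prod_mul_distrib]
    refine Finset.prod_congr rfl fun p _ => ?_
    rcases lt_trichotomy p.1 p.2 with h | h | h
    · simp [h, h.ne, h.not_gt]
    · simp [h]
    · simp [h, h.ne', h.not_gt]
  rw [h1, ← Equiv.prod_comp (Equiv.prodComm (Fin n) (Fin n)) fun p : Fin n × Fin n =>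
    if p.2 < p.1 then |t p.1 - t p.2| ^ c else 1, ← Finset.prod_mul_distrib, Finset.prod_filter]
  refine Finset.prod_congr rfl fun p _ => ?_
  simp only [Equiv.prodComm_apply, Prod.fst_swap, Prod.snd_swap]
  by_cases h : p.1 < p.2
  · have h0 : 0 < t p.2 - t p.1 := sub_pos.2 (ht h)
    simp only [h, if_true]
    rw [abs_sub_comm, abs_of_pos h0, ← Real.rpow_add h0, two_mul]
  · simp [h]

lemma selbergMoment_empty_eq (ha : 0 < a) (hb : 0 < b) (hc : 0 ≤ c) :
    selbergMoment a b c (∅ : Finset (Fin n)) = n.factorial * selbergOrdered n a b c := by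
  simp only [selbergMoment, Finset.prod_empty, one_mul]
  rw [integral_cube_eq_factorial_mul (integrable_selbergDensity ha hb hc)
    fun σ t => selbergDensity_comp_perm σ t, integral_indicator measurableSet_strictMono,
    selbergOrdered, cubeMeasure, ← Measure.restrict_pi_pi,
    Measure.restrict_restrict measurableSet_strictMono]
  have hset : {t : Fin n → ℝ | StrictMono t} ∩ Set.univ.pi (fun _ => Set.Ioo (0 : ℝ) 1) =
      {t | StrictMono t ∧ ∀ i, 0 < t i ∧ t i < 1} := by
    ext t
    simp [Set.mem_pi]
  have hmeas : MeasurableSet {t : Fin n → ℝ | StrictMono t ∧ ∀ i, 0 < t i ∧ t i < 1} :=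
    hset ▸ measurableSet_strictMono.inter (.univ_pi fun _ => measurableSet_Ioo)
  rw [hset]
  congr 1
  refine setIntegral_congr_fun hmeas fun t ht => ?_
  simp only [selbergDensity, betaWeight, interaction_of_strictMono ht.1]

lemma selbergMoment_univ :
    selbergMoment a b c (Finset.univ : Finset (Fin n)) =
      selbergMoment (a + 1) b c (∅ : Finset (Fin n)) := by
  refine integral_congr_ae ?_
  filter_upwards [ae_mem_cube n] with t ht
  rw [Finset.prod_empty, one_mul, selbergDensity, selbergDensity, ← mul_assoc,
    ← Finset.prod_mul_distrib]
  congr 1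
  exact Finset.prod_congr rfl fun k _ => (betaWeight_add_one (ht k)).symm

end Ordered

/-- the difference equation for the ordered Selberg integral:
for `m ≥ 1`, `a > 0`, `b > 0`, `c ≥ 0`,
`S_m(a+1,b,c) = (∏_{k=1}^m (a + c(m−k)) / (a + b + c(2m−k−1))) · S_m(a,b,c)`. -/
theorem selbergOrdered_difference_equation (m : ℕ) (hm : 1 ≤ m)
    (a b c : ℝ) (ha : 0 < a) (hb : 0 < b) (hc : 0 ≤ c) :
    selbergOrdered m (a + 1) b c
      = (∏ k ∈ Finset.Icc 1 m,
          (a + c * ((m : ℝ) - (k : ℝ))) / (a + b + c * (2 * (m : ℝ) - (k : ℝ) - 1)))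
        * selbergOrdered m a b c := by
  have h := selbergMoment_eq_prod_mul ha hb hc (Finset.univ : Finset (Fin m))
  rw [selbergMoment_univ, selbergMoment_empty_eq (by positivity) hb hc,
    selbergMoment_empty_eq ha hb hc, Finset.card_univ, Fintype.card_fin] at h
  have hfac : (m.factorial : ℝ) ≠ 0 := by positivity
  refine mul_left_cancel₀ hfac ?_
  rw [h]
  ring
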